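/- The SP semantics is injective on terms generated by the non-terminal A of the normal-form grammar: for all A-terms a1 and a2, if ⟦a1⟧ = ⟦a2⟧ then a1 = a2. -/

import Mathlib

/-!
Formalization of "Attack Trees with Sequential Conjunction".

Source-sink graphs over a set `B` of basic actions: a vertex type `V`,
a multiset of labeled edges, a source `s` and a sink `z` with `s ≠ z`.
-/

structure SSG (B : Type) : Type 1 where
  V : Type
  deq : DecidableEq V
  E : Multiset (V × B × V)
  s : V
  z : V
  ne : s ≠ z

namespace SSG

variable {B : Type}

/-- The graph with a single edge labeled `b`. -/
def single (b : B) : SSG B where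
  V := Bool
  deq := inferInstance
  E := {(false, b, true)}
  s := false
  z := true
  ne := Bool.false_ne_true

/-- In the sequential composition, the sink of the first graph is identified with
the source of the second graph. -/
def seqEmbed (G G' : SSG B) (v : G.V) : ({u : G.V // u ≠ G.z} ⊕ G'.V) :=
  haveI := G.deq
  if h : v = G.z then Sum.inr G'.s else Sum.inl ⟨v, h⟩

/-- Sequential composition `G ⋅ G'` of source-sink graphs: the disjoint union in which
the sink of `G` is identified with the source of `G'`. -/
def seq (G G' : SSG B) : SSG B where
  V := {u : G.V // u ≠ G.z} ⊕ G'.V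
  deq := by haveI := G.deq; haveI := G'.deq; infer_instance
  E := G.E.map (fun e => (G.seqEmbed G' e.1, e.2.1, G.seqEmbed G' e.2.2)) +
       G'.E.map (fun e => (Sum.inr e.1, e.2.1, Sum.inr e.2.2))
  s := Sum.inl ⟨G.s, G.ne⟩
  z := Sum.inr G'.z
  ne := by simp

/-- In the parallel composition, the two sources are identified and the two sinks
are identified. -/
def parEmbed (G G' : SSG B) (v : G.V) : ({u : G.V // u ≠ G.s ∧ u ≠ G.z} ⊕ G'.V) :=
  haveI := G.deq
  if hs : v = G.s then Sum.inr G'.s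
  else if hz : v = G.z then Sum.inr G'.z
  else Sum.inl ⟨v, hs, hz⟩

/-- Parallel composition `G ∥ G'` of source-sink graphs: the disjoint union in which
the two sources are identified and the two sinks are identified. -/
def par (G G' : SSG B) : SSG B where
  V := {u : G.V // u ≠ G.s ∧ u ≠ G.z} ⊕ G'.V
  deq := by haveI := G.deq; haveI := G'.deq; infer_instance
  E := G.E.map (fun e => (G.parEmbed G' e.1, e.2.1, G.parEmbed G' e.2.2)) +
       G'.E.map (fun e => (Sum.inr e.1, e.2.1, Sum.inr e.2.2))
  s := Sum.inr G'.s
  z := Sum.inr G'.z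
  ne := fun h => G'.ne (Sum.inr_injective h)

/-- Two source-sink graphs are equal (isomorphic) if there is a bijection between their
vertex sets that preserves the labeled edges (and hence source and sink). -/
def Iso (G G' : SSG B) : Prop :=
  ∃ f : G.V ≃ G'.V,
    G.E.map (fun e => (f e.1, e.2.1, f e.2.2)) = G'.E ∧ f G.s = G'.s ∧ f G.z = G'.z

/-- Directed adjacency: there is an edge from `u` to `v`. -/
def Adj (G : SSG B) (u v : G.V) : Prop := ∃ b, (u, b, v) ∈ G.E

/-- Series-parallel graphs (SP graphs): built from single edges by sequential and
parallel composition; as SP graphs are considered up to isomorphism, the collection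
is closed under isomorphism. -/
inductive IsSP : SSG B → Prop
  | single (b : B) : IsSP (single b)
  | seq {G G' : SSG B} : IsSP G → IsSP G' → IsSP (G.seq G')
  | par {G G' : SSG B} : IsSP G → IsSP G' → IsSP (G.par G')
  | iso {G G' : SSG B} : IsSP G → G.Iso G' → IsSP G'

/-- A graph is connected if any two vertices are joined by a path in the
underlying undirected graph. -/
def Connected (G : SSG B) : Prop :=
  ∀ u v : G.V, Relation.ReflTransGen (fun a b => G.Adj a b ∨ G.Adj b a) u v

/-- A directed graph is acyclic if it has no (nonempty) directed cycle. -/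
def Acyclic (G : SSG B) : Prop := ∀ v : G.V, ¬ Relation.TransGen G.Adj v v

end SSG
/-!
SAND attack trees: closed terms over `B ∪ {OR, AND, SAND}`, where the unranked
operators take `k ≥ 1` arguments (represented by nonempty lists `SandTreeList`).
-/

mutual
inductive SandTree (B : Type) : Type
  | atom : B → SandTree B
  | or : SandTreeList B → SandTree B
  | and : SandTreeList B → SandTree B
  | sand : SandTreeList B → SandTree B
inductive SandTreeList (B : Type) : Type
  | single : SandTree B → SandTreeList B
  | cons : SandTree B → SandTreeList B → SandTreeList B
end

namespace SandTreeList

variable {B : Type}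

def toList : SandTreeList B → List (SandTree B)
  | .single t => [t]
  | .cons t ts => t :: ts.toList

/-- Prepend a (possibly empty) list of trees to a nonempty argument list. -/
def glue : List (SandTree B) → SandTreeList B → SandTreeList B
  | [], ys => ys
  | x :: xs, ys => .cons x (glue xs ys)

/-- The nonempty argument list `t :: l`. -/
def ofList : SandTree B → List (SandTree B) → SandTreeList B
  | t, [] => .single t
  | t, u :: us => .cons t (ofList u us)

/-- Append a (possibly empty) list of trees to a nonempty argument list. -/
def snoc : SandTreeList B → List (SandTree B) → SandTreeList B
  | .single t, zs => ofList t zs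
  | .cons t ts, zs => .cons t (snoc ts zs)

def map (f : SandTree B → SandTree B) : SandTreeList B → SandTreeList B
  | .single t => .single (f t)
  | .cons t ts => .cons (f t) (map f ts)

end SandTreeList

/-!
The SP semantics `sem` interprets a SAND attack tree as a set of SP graphs
(sets of source-sink graphs closed under isomorphism, since SP graphs are
considered up to isomorphism):
`⟦b⟧ = {→b}`, `⟦OR(t₁,…,t_k)⟧ = ⋃ᵢ ⟦tᵢ⟧`,
`⟦AND(t₁,…,t_k)⟧ = {G₁ ∥ … ∥ G_k | Gᵢ ∈ ⟦tᵢ⟧}`,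
`⟦SAND(t₁,…,t_k)⟧ = {G₁ ⋅ … ⋅ G_k | Gᵢ ∈ ⟦tᵢ⟧}`.
-/

mutual
def sem {B : Type} : SandTree B → Set (SSG B)
  | .atom b => {G | (SSG.single b).Iso G}
  | .or ts => semOr ts
  | .and ts => semAnd ts
  | .sand ts => semSand ts
def semOr {B : Type} : SandTreeList B → Set (SSG B)
  | .single t => sem t
  | .cons t ts => sem t ∪ semOr ts
def semAnd {B : Type} : SandTreeList B → Set (SSG B)
  | .single t => sem t
  | .cons t ts => {G | ∃ G1 ∈ sem t, ∃ G2 ∈ semAnd ts, (G1.par G2).Iso G}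
def semSand {B : Type} : SandTreeList B → Set (SSG B)
  | .single t => sem t
  | .cons t ts => {G | ∃ G1 ∈ sem t, ∃ G2 ∈ semSand ts, (G1.seq G2).Iso G}
end
/-!
Equality of terms modulo commutativity of the unranked operators `OR` and `AND`
(the congruence generated by permuting the arguments of `OR` and `AND` nodes).
-/

mutual
inductive PEq {B : Type} : SandTree B → SandTree B → Prop
  | refl (t : SandTree B) : PEq t t
  | symm {t u : SandTree B} : PEq t u → PEq u t
  | trans {t u v : SandTree B} : PEq t u → PEq u v → PEq t v
  | orPerm {ts ts' : SandTreeList B} : ts.toList.Perm ts'.toList → PEq (.or ts) (.or ts')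
  | andPerm {ts ts' : SandTreeList B} : ts.toList.Perm ts'.toList → PEq (.and ts) (.and ts')
  | orCongr {ts ts' : SandTreeList B} : PEqL ts ts' → PEq (.or ts) (.or ts')
  | andCongr {ts ts' : SandTreeList B} : PEqL ts ts' → PEq (.and ts) (.and ts')
  | sandCongr {ts ts' : SandTreeList B} : PEqL ts ts' → PEq (.sand ts) (.sand ts')
inductive PEqL {B : Type} : SandTreeList B → SandTreeList B → Prop
  | single {t t' : SandTree B} : PEq t t' → PEqL (.single t) (.single t')
  | cons {t t' : SandTree B} {ts ts' : SandTreeList B} :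
      PEq t t' → PEqL ts ts' → PEqL (.cons t ts) (.cons t' ts')
end
/-!
Syntactic consequence from the axiom system `E_SP`.

The axiom schemes are represented by all of their instances (arbitrary argument
terms in place of the variable vectors `X⃗`, `Y⃗`, `Z⃗`); on closed terms this
generates exactly the same derivability relation as variables plus the
substitution rule.  Closure under "replacement in contexts" is represented by
the congruence rules for the three operators.
-/

section
open SandTreeList
mutual
inductive DerivSP {B : Type} : SandTree B → SandTree B → Prop
  /- closure rules -/
  | refl (t : SandTree B) : DerivSP t t
  | symm {t u : SandTree B} : DerivSP t u → DerivSP u t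
  | trans {t u v : SandTree B} : DerivSP t u → DerivSP u v → DerivSP t v
  | congrOr {ts ts' : SandTreeList B} : DerivSPL ts ts' → DerivSP (.or ts) (.or ts')
  | congrAnd {ts ts' : SandTreeList B} : DerivSPL ts ts' → DerivSP (.and ts) (.and ts')
  | congrSand {ts ts' : SandTreeList B} : DerivSPL ts ts' → DerivSP (.sand ts) (.sand ts')
  /- (E1) commutativity of OR -/
  | ax1 {ts ts' : SandTreeList B} : ts.toList.Perm ts'.toList → DerivSP (.or ts) (.or ts')
  /- (E2) commutativity of AND -/
  | ax2 {ts ts' : SandTreeList B} : ts.toList.Perm ts'.toList → DerivSP (.and ts) (.and ts')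
  /- (E3) OR(X⃗, OR(Y⃗)) = OR(X⃗, Y⃗) -/
  | ax3 (xs : List (SandTree B)) (ys : SandTreeList B) :
      DerivSP (.or (glue xs (.single (.or ys)))) (.or (glue xs ys))
  /- (E4) AND(X⃗, AND(Y⃗)) = AND(X⃗, Y⃗) -/
  | ax4 (xs : List (SandTree B)) (ys : SandTreeList B) :
      DerivSP (.and (glue xs (.single (.and ys)))) (.and (glue xs ys))
  /- (E4') SAND(X⃗, SAND(Y⃗), Z⃗) = SAND(X⃗, Y⃗, Z⃗) -/
  | ax4' (xs : List (SandTree B)) (ys : SandTreeList B) (zs : List (SandTree B)) :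
      DerivSP (.sand (glue xs (snoc (.single (.sand ys)) zs))) (.sand (glue xs (snoc ys zs)))
  /- (E5) OR(A) = A -/
  | ax5 (t : SandTree B) : DerivSP (.or (.single t)) t
  /- (E6) AND(A) = A -/
  | ax6 (t : SandTree B) : DerivSP (.and (.single t)) t
  /- (E6') SAND(A) = A -/
  | ax6' (t : SandTree B) : DerivSP (.sand (.single t)) t
  /- (E10) AND(X⃗, OR(Y⃗)) = OR(AND(X⃗,Y₁),…,AND(X⃗,Yₗ)) -/
  | ax10 (xs : List (SandTree B)) (ys : SandTreeList B) :
      DerivSP (.and (glue xs (.single (.or ys))))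
        (.or (SandTreeList.map (fun y => .and (glue xs (.single y))) ys))
  /- (E10') SAND(X⃗, OR(Y⃗), Z⃗) = OR(SAND(X⃗,Y₁,Z⃗),…,SAND(X⃗,Yₗ,Z⃗)) -/
  | ax10' (xs : List (SandTree B)) (ys : SandTreeList B) (zs : List (SandTree B)) :
      DerivSP (.sand (glue xs (snoc (.single (.or ys)) zs)))
        (.or (SandTreeList.map (fun y => .sand (glue xs (snoc (.single y) zs))) ys))
  /- (E11) OR(A, A, X⃗) = OR(A, X⃗) -/
  | ax11 (a : SandTree B) (xs : List (SandTree B)) :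
      DerivSP (.or (.cons a (ofList a xs))) (.or (ofList a xs))
inductive DerivSPL {B : Type} : SandTreeList B → SandTreeList B → Prop
  | single {t t' : SandTree B} : DerivSP t t' → DerivSPL (.single t) (.single t')
  | cons {t t' : SandTree B} {ts ts' : SandTreeList B} :
      DerivSP t t' → DerivSPL ts ts' → DerivSPL (.cons t ts) (.cons t' ts')
end
end

/-! Syntactic consequence from the SAND-free fragment
`E_SM = {E1, E2, E3, E4, E5, E6, E10, E11}` of `E_SP` (formulated over the full
signature of SAND attack trees). -/
section
open SandTreeList
mutual
inductive DerivSM {B : Type} : SandTree B → SandTree B → Prop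
  | refl (t : SandTree B) : DerivSM t t
  | symm {t u : SandTree B} : DerivSM t u → DerivSM u t
  | trans {t u v : SandTree B} : DerivSM t u → DerivSM u v → DerivSM t v
  | congrOr {ts ts' : SandTreeList B} : DerivSML ts ts' → DerivSM (.or ts) (.or ts')
  | congrAnd {ts ts' : SandTreeList B} : DerivSML ts ts' → DerivSM (.and ts) (.and ts')
  | congrSand {ts ts' : SandTreeList B} : DerivSML ts ts' → DerivSM (.sand ts) (.sand ts')
  | ax1 {ts ts' : SandTreeList B} : ts.toList.Perm ts'.toList → DerivSM (.or ts) (.or ts')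
  | ax2 {ts ts' : SandTreeList B} : ts.toList.Perm ts'.toList → DerivSM (.and ts) (.and ts')
  | ax3 (xs : List (SandTree B)) (ys : SandTreeList B) :
      DerivSM (.or (glue xs (.single (.or ys)))) (.or (glue xs ys))
  | ax4 (xs : List (SandTree B)) (ys : SandTreeList B) :
      DerivSM (.and (glue xs (.single (.and ys)))) (.and (glue xs ys))
  | ax5 (t : SandTree B) : DerivSM (.or (.single t)) t
  | ax6 (t : SandTree B) : DerivSM (.and (.single t)) t
  | ax10 (xs : List (SandTree B)) (ys : SandTreeList B) :
      DerivSM (.and (glue xs (.single (.or ys))))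
        (.or (SandTreeList.map (fun y => .and (glue xs (.single y))) ys))
  | ax11 (a : SandTree B) (xs : List (SandTree B)) :
      DerivSM (.or (.cons a (ofList a xs))) (.or (ofList a xs))
inductive DerivSML {B : Type} : SandTreeList B → SandTreeList B → Prop
  | single {t t' : SandTree B} : DerivSM t t' → DerivSML (.single t) (.single t')
  | cons {t t' : SandTree B} {ts ts' : SandTreeList B} :
      DerivSM t t' → DerivSML ts ts' → DerivSML (.cons t ts) (.cons t' ts')
end
end
/-!
The normal-form grammar (for `k ≥ 2`, `b ∈ B`):
`N ::= A | OR(A₁,…,A_k)` (with pairwise distinct `Aᵢ`),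
`A ::= C | S`, `C ::= b | AND(S₁,…,S_k)`, `S ::= b | SAND(C₁,…,C_k)`.
-/

mutual
inductive IsC {B : Type} : SandTree B → Prop
  | atom (b : B) : IsC (.atom b)
  | and {ts : SandTreeList B} : 2 ≤ ts.toList.length → IsSL ts → IsC (.and ts)
inductive IsS {B : Type} : SandTree B → Prop
  | atom (b : B) : IsS (.atom b)
  | sand {ts : SandTreeList B} : 2 ≤ ts.toList.length → IsCL ts → IsS (.sand ts)
inductive IsSL {B : Type} : SandTreeList B → Prop
  | single {t : SandTree B} : IsS t → IsSL (.single t)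
  | cons {t : SandTree B} {ts : SandTreeList B} : IsS t → IsSL ts → IsSL (.cons t ts)
inductive IsCL {B : Type} : SandTreeList B → Prop
  | single {t : SandTree B} : IsC t → IsCL (.single t)
  | cons {t : SandTree B} {ts : SandTreeList B} : IsC t → IsCL ts → IsCL (.cons t ts)
end

/-- Terms generated by the non-terminal `A` of the normal-form grammar. -/
def IsA {B : Type} (t : SandTree B) : Prop := IsC t ∨ IsS t

/-- Terms generated by the non-terminal `N` of the normal-form grammar; as terms
are considered modulo commutativity of `OR` and `AND`, the arguments of the `OR`
are required to be pairwise distinct modulo commutativity. -/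
def IsN {B : Type} (t : SandTree B) : Prop :=
  IsA t ∨ ∃ ts : SandTreeList B, t = .or ts ∧ 2 ≤ ts.toList.length ∧
    (∀ u ∈ ts.toList, IsA u) ∧ ts.toList.Pairwise (fun a b => ¬ PEq a b)

/-!
The term rewriting system obtained by orienting the axioms
(E3), (E4), (E4'), (E5), (E6), (E6'), (E10), (E10'), (E11) from left to right,
applied in any context, modulo commutativity of `OR` and `AND`.
-/

section
open SandTreeList

/-- Rule application at the root. -/
inductive RStep {B : Type} : SandTree B → SandTree B → Prop
  | r3 (xs : List (SandTree B)) (ys : SandTreeList B) :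
      RStep (.or (glue xs (.single (.or ys)))) (.or (glue xs ys))
  | r4 (xs : List (SandTree B)) (ys : SandTreeList B) :
      RStep (.and (glue xs (.single (.and ys)))) (.and (glue xs ys))
  | r4' (xs : List (SandTree B)) (ys : SandTreeList B) (zs : List (SandTree B)) :
      RStep (.sand (glue xs (snoc (.single (.sand ys)) zs))) (.sand (glue xs (snoc ys zs)))
  | r5 (t : SandTree B) : RStep (.or (.single t)) t
  | r6 (t : SandTree B) : RStep (.and (.single t)) t
  | r6' (t : SandTree B) : RStep (.sand (.single t)) t
  | r10 (xs : List (SandTree B)) (ys : SandTreeList B) :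
      RStep (.and (glue xs (.single (.or ys))))
        (.or (SandTreeList.map (fun y => .and (glue xs (.single y))) ys))
  | r10' (xs : List (SandTree B)) (ys : SandTreeList B) (zs : List (SandTree B)) :
      RStep (.sand (glue xs (snoc (.single (.or ys)) zs)))
        (.or (SandTreeList.map (fun y => .sand (glue xs (snoc (.single y) zs))) ys))
  | r11 (a : SandTree B) (xs : List (SandTree B)) :
      RStep (.or (.cons a (ofList a xs))) (.or (ofList a xs))

end

/-! Rule application in an arbitrary context. -/
mutual
inductive Rw {B : Type} : SandTree B → SandTree B → Prop
  | root {t t' : SandTree B} : RStep t t' → Rw t t'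
  | or {ts ts' : SandTreeList B} : RwL ts ts' → Rw (.or ts) (.or ts')
  | and {ts ts' : SandTreeList B} : RwL ts ts' → Rw (.and ts) (.and ts')
  | sand {ts ts' : SandTreeList B} : RwL ts ts' → Rw (.sand ts) (.sand ts')
inductive RwL {B : Type} : SandTreeList B → SandTreeList B → Prop
  | single {t t' : SandTree B} : Rw t t' → RwL (.single t) (.single t')
  | head {t t' : SandTree B} {ts : SandTreeList B} : Rw t t' → RwL (.cons t ts) (.cons t' ts)
  | tail {t : SandTree B} {ts ts' : SandTreeList B} : RwL ts ts' → RwL (.cons t ts) (.cons t ts')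
end

/-- One rewrite step of the TRS `⇒`, working modulo commutativity of `OR` and `AND`. -/
def RwMod {B : Type} (t t' : SandTree B) : Prop :=
  ∃ u u' : SandTree B, PEq t u ∧ Rw u u' ∧ PEq u' t'

/-- Zero or more rewrite steps (modulo commutativity of `OR` and `AND`). -/
def RwStar {B : Type} : SandTree B → SandTree B → Prop :=
  Relation.ReflTransGen (fun a b => PEq a b ∨ Rw a b)

/-- A normal form: no rewrite rule is applicable, modulo commutativity of `OR` and `AND`. -/
def NormalForm {B : Type} (t : SandTree B) : Prop :=
  ∀ u t' : SandTree B, PEq t u → ¬ Rw u t'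

/-! The norm `‖·‖`: `‖b‖ = 1`, `‖OR(t₁,…,t_k)‖ = ‖t₁‖+…+‖t_k‖+2`,
`‖AND(t₁,…,t_k)‖ = ‖SAND(t₁,…,t_k)‖ = 2·‖t₁‖·…·‖t_k‖`. -/
mutual
def weight {B : Type} : SandTree B → ℕ
  | .atom _ => 1
  | .or ts => weightSum ts + 2
  | .and ts => 2 * weightProd ts
  | .sand ts => 2 * weightProd ts
def weightSum {B : Type} : SandTreeList B → ℕ
  | .single t => weight t
  | .cons t ts => weight t + weightSum ts
def weightProd {B : Type} : SandTreeList B → ℕ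
  | .single t => weight t
  | .cons t ts => weight t * weightProd ts
end
/-!
Standard attack trees are SAND attack trees containing no `SAND` operator.
The multiset semantics maps a standard attack tree to a set of finite multisets
over `B`: `⟦b⟧_M = {⟨b⟩}`, `⟦OR⟧_M = ⋃ᵢ ⟦tᵢ⟧_M`,
`⟦AND⟧_M = {M₁ ⊎ … ⊎ M_k | Mᵢ ∈ ⟦tᵢ⟧_M}`.
(Its value on trees containing `SAND` is irrelevant and set to `∅`.)
-/

mutual
inductive NoSand {B : Type} : SandTree B → Prop
  | atom (b : B) : NoSand (.atom b)
  | or {ts : SandTreeList B} : NoSandL ts → NoSand (.or ts)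
  | and {ts : SandTreeList B} : NoSandL ts → NoSand (.and ts)
inductive NoSandL {B : Type} : SandTreeList B → Prop
  | single {t : SandTree B} : NoSand t → NoSandL (.single t)
  | cons {t : SandTree B} {ts : SandTreeList B} : NoSand t → NoSandL ts → NoSandL (.cons t ts)
end

mutual
def msem {B : Type} : SandTree B → Set (Multiset B)
  | .atom b => {({b} : Multiset B)}
  | .or ts => msemOr ts
  | .and ts => msemAnd ts
  | .sand _ => ∅
def msemOr {B : Type} : SandTreeList B → Set (Multiset B)
  | .single t => msem t
  | .cons t ts => msem t ∪ msemOr ts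
def msemAnd {B : Type} : SandTreeList B → Set (Multiset B)
  | .single t => msem t
  | .cons t ts => {M | ∃ M1 ∈ msem t, ∃ M2 ∈ msemAnd ts, M = M1 + M2}
end

/-- Parallel composition of a nonempty list of graphs `G ∥ H₁ ∥ … ∥ H_k`. -/
def parAll {B : Type} : SSG B → List (SSG B) → SSG B
  | G, [] => G
  | G, H :: Hs => parAll (G.par H) Hs

/-- SAND attack trees modulo equivalence with respect to the SP semantics
(`t ~ t'` iff `⟦t⟧ = ⟦t'⟧`). -/
def semSetoid (B : Type) : Setoid (SandTree B) :=
  ⟨fun t t' => sem t = sem t', fun _ => rfl, Eq.symm, Eq.trans⟩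

/-- The map induced by the SP semantics on equivalence classes of SAND attack trees. -/
def semClass {B : Type} : Quotient (semSetoid B) → Set (SSG B) :=
  Quotient.lift sem (fun _ _ h => h)

/-!
Bottom-up evaluation of the minimal attack time attribute on SAND attack trees:
`α(b) = β(b)`, `α(OR) = min`, `α(AND) = max`, `α(SAND) = Σ`.
-/

mutual
def attr {B : Type} (β : B → NNReal) : SandTree B → NNReal
  | .atom b => β b
  | .or ts => attrOr β ts
  | .and ts => attrAnd β ts
  | .sand ts => attrSand β ts
def attrOr {B : Type} (β : B → NNReal) : SandTreeList B → NNReal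
  | .single t => attr β t
  | .cons t ts => min (attr β t) (attrOr β ts)
def attrAnd {B : Type} (β : B → NNReal) : SandTreeList B → NNReal
  | .single t => attr β t
  | .cons t ts => max (attr β t) (attrAnd β ts)
def attrSand {B : Type} (β : B → NNReal) : SandTreeList B → NNReal
  | .single t => attr β t
  | .cons t ts => attr β t + attrSand β ts
end
/-!
Standard attack trees as a standalone signature (`B ∪ {OR, AND}`, unranked
operators with `k ≥ 1` arguments), their multiset semantics, and syntactic
consequence from the axiom system `E_SM`.
-/

mutual
inductive ATree (B : Type) : Type
  | atom : B → ATree B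
  | or : ATreeList B → ATree B
  | and : ATreeList B → ATree B
inductive ATreeList (B : Type) : Type
  | single : ATree B → ATreeList B
  | cons : ATree B → ATreeList B → ATreeList B
end

namespace ATreeList

variable {B : Type}

def toList : ATreeList B → List (ATree B)
  | .single t => [t]
  | .cons t ts => t :: ts.toList

def glue : List (ATree B) → ATreeList B → ATreeList B
  | [], ys => ys
  | x :: xs, ys => .cons x (glue xs ys)

def ofList : ATree B → List (ATree B) → ATreeList B
  | t, [] => .single t
  | t, u :: us => .cons t (ofList u us)

def map (f : ATree B → ATree B) : ATreeList B → ATreeList B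
  | .single t => .single (f t)
  | .cons t ts => .cons (f t) (map f ts)

end ATreeList

/-! The multiset semantics of standard attack trees. -/

mutual
def amsem {B : Type} : ATree B → Set (Multiset B)
  | .atom b => {({b} : Multiset B)}
  | .or ts => amsemOr ts
  | .and ts => amsemAnd ts
def amsemOr {B : Type} : ATreeList B → Set (Multiset B)
  | .single t => amsem t
  | .cons t ts => amsem t ∪ amsemOr ts
def amsemAnd {B : Type} : ATreeList B → Set (Multiset B)
  | .single t => amsem t
  | .cons t ts => {M | ∃ M1 ∈ amsem t, ∃ M2 ∈ amsemAnd ts, M = M1 + M2}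
end

/-!
Syntactic consequence from `E_SM = {E1, E2, E3, E4, E5, E6, E10, E11}`.
Axiom schemes are represented by all of their instances (closure under
substitution is then automatic), and closure under replacement in contexts is
represented by the congruence rules.
-/

section
open ATreeList
mutual
inductive DerivASM {B : Type} : ATree B → ATree B → Prop
  | refl (t : ATree B) : DerivASM t t
  | symm {t u : ATree B} : DerivASM t u → DerivASM u t
  | trans {t u v : ATree B} : DerivASM t u → DerivASM u v → DerivASM t v
  | congrOr {ts ts' : ATreeList B} : DerivASML ts ts' → DerivASM (.or ts) (.or ts')
  | congrAnd {ts ts' : ATreeList B} : DerivASML ts ts' → DerivASM (.and ts) (.and ts')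
  /- (E1) -/
  | ax1 {ts ts' : ATreeList B} : ts.toList.Perm ts'.toList → DerivASM (.or ts) (.or ts')
  /- (E2) -/
  | ax2 {ts ts' : ATreeList B} : ts.toList.Perm ts'.toList → DerivASM (.and ts) (.and ts')
  /- (E3) -/
  | ax3 (xs : List (ATree B)) (ys : ATreeList B) :
      DerivASM (.or (glue xs (.single (.or ys)))) (.or (glue xs ys))
  /- (E4) -/
  | ax4 (xs : List (ATree B)) (ys : ATreeList B) :
      DerivASM (.and (glue xs (.single (.and ys)))) (.and (glue xs ys))
  /- (E5) -/
  | ax5 (t : ATree B) : DerivASM (.or (.single t)) t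
  /- (E6) -/
  | ax6 (t : ATree B) : DerivASM (.and (.single t)) t
  /- (E10) -/
  | ax10 (xs : List (ATree B)) (ys : ATreeList B) :
      DerivASM (.and (glue xs (.single (.or ys))))
        (.or (ATreeList.map (fun y => .and (glue xs (.single y))) ys))
  /- (E11) -/
  | ax11 (a : ATree B) (xs : List (ATree B)) :
      DerivASM (.or (.cons a (ofList a xs))) (.or (ofList a xs))
inductive DerivASML {B : Type} : ATreeList B → ATreeList B → Prop
  | single {t t' : ATree B} : DerivASM t t' → DerivASML (.single t) (.single t')
  | cons {t t' : ATree B} {ts ts' : ATreeList B} :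
      DerivASM t t' → DerivASML ts ts' → DerivASML (.cons t ts) (.cons t' ts')
end
end
/-! ### Binary relations -/

namespace Relation

variable {α β : Type*}

/-- A path starting in a forward-closed copy of `ra` inside `r` is a path of `ra`. -/
theorem TransGen.exists_of_forward_closed {ra : α → α → Prop} {r : β → β → Prop} {f : α → β}
    (hf : ∀ a y, r (f a) y → ∃ a', y = f a' ∧ ra a a') {a : α} {y : β}
    (h : TransGen r (f a) y) : ∃ a', y = f a' ∧ TransGen ra a a' := by
  induction h with
  | single h =>
    obtain ⟨a', rfl, h'⟩ := hf _ _ h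
    exact ⟨a', rfl, .single h'⟩
  | tail _ h ih =>
    obtain ⟨b, rfl, hb⟩ := ih
    obtain ⟨a', rfl, h'⟩ := hf _ _ h
    exact ⟨a', rfl, hb.tail h'⟩

/-- A path ending in a backward-closed copy of `ra` inside `r` is a path of `ra`. -/
theorem TransGen.exists_of_backward_closed {ra : α → α → Prop} {r : β → β → Prop} {f : α → β}
    (hf : ∀ a y, r y (f a) → ∃ a', y = f a' ∧ ra a' a) {a : α} {y : β}
    (h : TransGen r y (f a)) : ∃ a', y = f a' ∧ TransGen ra a' a := by
  induction h using TransGen.head_induction_on with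
  | single h =>
    obtain ⟨a', rfl, h'⟩ := hf _ _ h
    exact ⟨a', rfl, .single h'⟩
  | head h _ ih =>
    obtain ⟨b, rfl, hb⟩ := ih
    obtain ⟨a', rfl, h'⟩ := hf _ _ h
    exact ⟨a', rfl, .head h' hb⟩

end Relation

/-- Two indexings of the same finite multiset differ by a bijection of the index types. -/
theorem Fintype.exists_equiv_of_map_univ_eq {ι κ α : Type*} [Fintype ι] [Fintype κ]
    {f : ι → α} {g : κ → α} (h : Finset.univ.val.map f = Finset.univ.val.map g) :
    ∃ e : ι ≃ κ, ∀ i, g (e i) = f i := by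
  classical
  have hc : ∀ c, Nonempty ({i // f i = c} ≃ {k // g k = c}) := by
    intro c
    have := congrArg (Multiset.count c) h
    rw [Multiset.count_map, Multiset.count_map] at this
    refine ⟨Fintype.equivOfCardEq ?_⟩
    rw [Fintype.card_subtype, Fintype.card_subtype, Finset.card_def, Finset.card_def,
      Finset.filter_val, Finset.filter_val]
    simpa only [eq_comm] using this
  refine ⟨(Equiv.sigmaFiberEquiv f).symm.trans
    ((Equiv.sigmaCongrRight fun c => Classical.choice (hc c)).trans (Equiv.sigmaFiberEquiv g)), ?_⟩
  intro i
  exact ((Classical.choice (hc (f i))) ⟨i, rfl⟩).2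

/-! ### Connected sets -/

section Connectivity

variable {X : Type*}

/-- A nonempty set any two of whose points are joined by an `r`-path inside the set. -/
def ConnectedIn (r : X → X → Prop) (S : Set X) : Prop :=
  S.Nonempty ∧ ∀ x ∈ S, ∀ y ∈ S, Relation.ReflTransGen (fun a b => b ∈ S ∧ r a b) x y

theorem connectedIn_singleton (r : X → X → Prop) (x : X) : ConnectedIn r {x} := by
  refine ⟨⟨x, rfl⟩, ?_⟩
  rintro _ rfl _ rfl
  exact .refl

theorem connectedIn_union {r : X → X → Prop} {S T : Set X} (hS : S.Nonempty) (hT : T.Nonempty)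
    (h : ∀ x ∈ S, ∀ y ∈ T, r x y ∧ r y x) : ConnectedIn r (S ∪ T) := by
  obtain ⟨s, hs⟩ := hS
  obtain ⟨t, ht⟩ := hT
  refine ⟨⟨s, .inl hs⟩, ?_⟩
  rintro x (hx | hx) y (hy | hy)
  · exact .tail (.single ⟨.inr ht, (h x hx t ht).1⟩) ⟨.inl hy, (h y hy t ht).2⟩
  · exact .single ⟨.inr hy, (h x hx y hy).1⟩
  · exact .single ⟨.inl hy, (h y hy x hx).2⟩
  · exact .tail (.single ⟨.inl hs, (h s hs x hx).2⟩) ⟨.inr hy, (h s hs y hy).1⟩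

theorem ConnectedIn.subset {r : X → X → Prop} {A T : Set X} (hA : ConnectedIn r A)
    (hT : ∀ a ∈ T, ∀ b ∈ A, r a b → b ∈ T) (hAT : (A ∩ T).Nonempty) : A ⊆ T := by
  obtain ⟨x, hxA, hxT⟩ := hAT
  intro y hy
  have h := hA.2 x hxA y hy
  clear hy
  induction h with
  | refl => exact hxT
  | tail _ h ih => exact hT _ ih _ h.1 h.2

end Connectivity

/-! ### Attack trees read off from a labelled order -/

section Represents

variable {B : Type} {X : Type*} (lt : X → X → Prop) (lab : X → B)

mutual
/-- `Represents lt lab t S`: the labelled relation `lt` restricted to `S` is a series-parallel order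
whose decomposition is given by the tree `t`, up to a choice of one argument in each `OR`. -/
def Represents : SandTree B → Set X → Prop
  | .atom b, S => ∃ x, S = {x} ∧ lab x = b
  | .or ts, S => RepresentsOr ts S
  | .and ts, S => RepresentsAnd ts S
  | .sand ts, S => RepresentsSand ts S
def RepresentsOr : SandTreeList B → Set X → Prop
  | .single t, S => Represents t S
  | .cons t ts, S => Represents t S ∨ RepresentsOr ts S
def RepresentsAnd : SandTreeList B → Set X → Prop
  | .single t, S => Represents t S
  | .cons t ts, S => ∃ S₁ S₂, S = S₁ ∪ S₂ ∧
      (∀ x ∈ S₁, ∀ y ∈ S₂, x ≠ y ∧ ¬ (lt x y ∨ lt y x)) ∧ Represents t S₁ ∧ RepresentsAnd ts S₂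
def RepresentsSand : SandTreeList B → Set X → Prop
  | .single t, S => Represents t S
  | .cons t ts, S => ∃ S₁ S₂, S = S₁ ∪ S₂ ∧
      (∀ x ∈ S₁, ∀ y ∈ S₂, lt x y ∧ ¬ lt y x) ∧ Represents t S₁ ∧ RepresentsSand ts S₂
end

section Image

set_option linter.unusedSectionVars false

variable {Y : Type*} {lt lab} {lt' : Y → Y → Prop} {lab' : Y → B} {f : X → Y}
  (hf : Function.Injective f) (hlt : ∀ x y, lt' (f x) (f y) ↔ lt x y)
  (hlab : ∀ x, lab' (f x) = lab x)

include hf hlt hlab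

mutual
theorem Represents.image :
    ∀ (t : SandTree B) {S : Set X}, Represents lt lab t S → Represents lt' lab' t (f '' S)
  | .atom b, S, h => by
    obtain ⟨x, rfl, rfl⟩ := h
    exact ⟨f x, Set.image_singleton, hlab x⟩
  | .or ts, S, h => RepresentsOr.image ts h
  | .and ts, S, h => RepresentsAnd.image ts h
  | .sand ts, S, h => RepresentsSand.image ts h
theorem RepresentsOr.image :
    ∀ (ts : SandTreeList B) {S : Set X},
      RepresentsOr lt lab ts S → RepresentsOr lt' lab' ts (f '' S)
  | .single t, _, h => Represents.image t h
  | .cons t ts, _, h => h.imp (Represents.image t) (RepresentsOr.image ts)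
theorem RepresentsAnd.image :
    ∀ (ts : SandTreeList B) {S : Set X},
      RepresentsAnd lt lab ts S → RepresentsAnd lt' lab' ts (f '' S)
  | .single t, S, h => Represents.image t h
  | .cons t ts, S, h => by
    obtain ⟨S₁, S₂, rfl, h, h₁, h₂⟩ := h
    refine ⟨f '' S₁, f '' S₂, Set.image_union .., ?_, Represents.image t h₁,
      RepresentsAnd.image ts h₂⟩
    rintro _ ⟨x, hx, rfl⟩ _ ⟨y, hy, rfl⟩
    simpa only [hlt, hf.ne_iff] using h x hx y hy
theorem RepresentsSand.image :
    ∀ (ts : SandTreeList B) {S : Set X},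
      RepresentsSand lt lab ts S → RepresentsSand lt' lab' ts (f '' S)
  | .single t, S, h => Represents.image t h
  | .cons t ts, S, h => by
    obtain ⟨S₁, S₂, rfl, h, h₁, h₂⟩ := h
    refine ⟨f '' S₁, f '' S₂, Set.image_union .., ?_, Represents.image t h₁,
      RepresentsSand.image ts h₂⟩
    rintro _ ⟨x, hx, rfl⟩ _ ⟨y, hy, rfl⟩
    simpa only [hlt] using h x hx y hy
end

end Image

variable {lt lab}

mutual
theorem Represents.nonempty : ∀ (t : SandTree B) {S : Set X}, Represents lt lab t S → S.Nonempty
  | .atom _, _, ⟨x, h, _⟩ => h ▸ Set.singleton_nonempty x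
  | .or ts, _, h => RepresentsOr.nonempty ts h
  | .and ts, _, h => RepresentsAnd.nonempty ts h
  | .sand ts, _, h => RepresentsSand.nonempty ts h
theorem RepresentsOr.nonempty :
    ∀ (ts : SandTreeList B) {S : Set X}, RepresentsOr lt lab ts S → S.Nonempty
  | .single t, _, h => Represents.nonempty t h
  | .cons t ts, _, h => h.elim (Represents.nonempty t) (RepresentsOr.nonempty ts)
theorem RepresentsAnd.nonempty :
    ∀ (ts : SandTreeList B) {S : Set X}, RepresentsAnd lt lab ts S → S.Nonempty
  | .single t, _, h => Represents.nonempty t h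
  | .cons t _, _, ⟨_, _, h, _, h₁, _⟩ => h ▸ (Represents.nonempty t h₁).inl
theorem RepresentsSand.nonempty :
    ∀ (ts : SandTreeList B) {S : Set X}, RepresentsSand lt lab ts S → S.Nonempty
  | .single t, _, h => Represents.nonempty t h
  | .cons t _, _, ⟨_, _, h, _, h₁, _⟩ => h ▸ (Represents.nonempty t h₁).inl
end

theorem RepresentsAnd.exists_list :
    ∀ (ts : SandTreeList B) {S : Set X}, RepresentsAnd lt lab ts S →
    ∃ Ss : List (Set X), List.Forall₂ (Represents lt lab) ts.toList Ss ∧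
      (∀ x, x ∈ S ↔ ∃ A ∈ Ss, x ∈ A) ∧
      Ss.Pairwise fun A A' => ∀ x ∈ A, ∀ y ∈ A', x ≠ y ∧ ¬ (lt x y ∨ lt y x)
  | .single _, S, h => ⟨[S], .cons h .nil, by simp, by simp⟩
  | .cons _ ts, S, h => by
    obtain ⟨S₁, S₂, rfl, h, h₁, h₂⟩ := h
    obtain ⟨Ss, hF, hS, hP⟩ := RepresentsAnd.exists_list ts h₂
    refine ⟨S₁ :: Ss, .cons h₁ hF, fun x => by simp [hS], List.pairwise_cons.2 ⟨?_, hP⟩⟩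
    exact fun A hA x hx y hy => h x hx y ((hS y).2 ⟨A, hA, hy⟩)

theorem RepresentsSand.exists_list :
    ∀ (ts : SandTreeList B) {S : Set X}, RepresentsSand lt lab ts S →
    ∃ Ss : List (Set X), List.Forall₂ (Represents lt lab) ts.toList Ss ∧
      (∀ x, x ∈ S ↔ ∃ A ∈ Ss, x ∈ A) ∧
      Ss.Pairwise fun A A' => ∀ x ∈ A, ∀ y ∈ A', lt x y ∧ ¬ lt y x
  | .single _, S, h => ⟨[S], .cons h .nil, by simp, by simp⟩
  | .cons _ ts, S, h => by
    obtain ⟨S₁, S₂, rfl, h, h₁, h₂⟩ := h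
    obtain ⟨Ss, hF, hS, hP⟩ := RepresentsSand.exists_list ts h₂
    refine ⟨S₁ :: Ss, .cons h₁ hF, fun x => by simp [hS], List.pairwise_cons.2 ⟨?_, hP⟩⟩
    exact fun A hA x hx y hy => h x hx y ((hS y).2 ⟨A, hA, hy⟩)

theorem RepresentsAnd.exists_union {ts : SandTreeList B} {S : Set X} (hts : 2 ≤ ts.toList.length)
    (h : RepresentsAnd lt lab ts S) : ∃ S₁ S₂ : Set X, S = S₁ ∪ S₂ ∧ S₁.Nonempty ∧ S₂.Nonempty ∧
      ∀ x ∈ S₁, ∀ y ∈ S₂, x ≠ y ∧ ¬ (lt x y ∨ lt y x) := by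
  cases ts with
  | single t => simp [SandTreeList.toList] at hts
  | cons t ts =>
    obtain ⟨S₁, S₂, hS, h, h₁, h₂⟩ := h
    exact ⟨S₁, S₂, hS, h₁.nonempty, h₂.nonempty, h⟩

theorem RepresentsSand.exists_union {ts : SandTreeList B} {S : Set X} (hts : 2 ≤ ts.toList.length)
    (h : RepresentsSand lt lab ts S) : ∃ S₁ S₂ : Set X, S = S₁ ∪ S₂ ∧ S₁.Nonempty ∧ S₂.Nonempty ∧
      ∀ x ∈ S₁, ∀ y ∈ S₂, lt x y ∧ ¬ lt y x := by
  cases ts with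
  | single t => simp [SandTreeList.toList] at hts
  | cons t ts =>
    obtain ⟨S₁, S₂, hS, h, h₁, h₂⟩ := h
    exact ⟨S₁, S₂, hS, h₁.nonempty, h₂.nonempty, h⟩

theorem Represents.connectedIn_of_isS {t : SandTree B} {S : Set X} (ht : IsS t)
    (h : Represents lt lab t S) :
    ConnectedIn (fun x y => lt x y ∨ lt y x) S := by
  cases ht with
  | atom b =>
    obtain ⟨x, rfl, -⟩ := h
    exact connectedIn_singleton _ x
  | sand hts _ =>
    obtain ⟨S₁, S₂, rfl, h₁, h₂, h⟩ := RepresentsSand.exists_union hts h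
    exact connectedIn_union h₁ h₂ fun x hx y hy => ⟨.inl (h x hx y hy).1, .inr (h x hx y hy).1⟩

theorem Represents.connectedIn_of_isC {t : SandTree B} {S : Set X} (ht : IsC t)
    (h : Represents lt lab t S) :
    ConnectedIn (fun x y => ¬ (lt x y ∨ lt y x)) S := by
  cases ht with
  | atom b =>
    obtain ⟨x, rfl, -⟩ := h
    exact connectedIn_singleton _ x
  | and hts _ =>
    obtain ⟨S₁, S₂, rfl, h₁, h₂, h⟩ := RepresentsAnd.exists_union hts h
    exact connectedIn_union h₁ h₂ fun x hx y hy =>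
      ⟨(h x hx y hy).2, fun hl => (h x hx y hy).2 hl.symm⟩

theorem Represents.not_representsAnd_of_isS {t : SandTree B} {S : Set X} (ht : IsS t)
    (h : Represents lt lab t S)
    {ts : SandTreeList B} (hts : 2 ≤ ts.toList.length) : ¬ RepresentsAnd lt lab ts S := by
  intro h'
  obtain ⟨S₁, S₂, rfl, ⟨x, hx⟩, ⟨y, hy⟩, hd⟩ := h'.exists_union hts
  have hsub := (h.connectedIn_of_isS ht).subset (T := S₁)
    (fun a ha b hb hab => hb.resolve_right fun hb => (hd a ha b hb).2 hab) ⟨x, .inl hx, hx⟩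
  exact (hd y (hsub (.inr hy)) y hy).1 rfl

theorem Represents.not_representsSand_of_isC {t : SandTree B} {S : Set X} (ht : IsC t)
    (h : Represents lt lab t S)
    {ts : SandTreeList B} (hts : 2 ≤ ts.toList.length) : ¬ RepresentsSand lt lab ts S := by
  intro h'
  obtain ⟨S₁, S₂, rfl, ⟨x, hx⟩, ⟨y, hy⟩, hd⟩ := h'.exists_union hts
  have hsub := (h.connectedIn_of_isC ht).subset (T := S₁)
    (fun a ha b hb hab => hb.resolve_right fun hb => hab (.inl (hd a ha b hb).1)) ⟨x, .inl hx, hx⟩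
  exact (hd y (hsub (.inr hy)) y hy).2 (hd y (hsub (.inr hy)) y hy).1

/-- Two decompositions of a set into `r`-connected blocks without `r`-relations between distinct
blocks have the same blocks. -/
theorem ConnectedIn.mem_of_mem {r : X → X → Prop} {Ss Ts : List (Set X)}
    (hU : ∀ x, (∃ A ∈ Ss, x ∈ A) ↔ ∃ A ∈ Ts, x ∈ A)
    (hS : ∀ A ∈ Ss, ConnectedIn r A) (hT : ∀ A ∈ Ts, ConnectedIn r A)
    (hSr : ∀ A ∈ Ss, ∀ A' ∈ Ss, A ≠ A' → ∀ x ∈ A, ∀ y ∈ A', ¬ r x y)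
    (hTr : ∀ A ∈ Ts, ∀ A' ∈ Ts, A ≠ A' → ∀ x ∈ A, ∀ y ∈ A', ¬ r x y)
    {A : Set X} (hA : A ∈ Ss) : A ∈ Ts := by
  obtain ⟨x, hx⟩ := (hS A hA).1
  obtain ⟨A', hA', hx'⟩ := (hU x).1 ⟨A, hA, hx⟩
  have h₁ : A ⊆ A' := by
    refine (hS A hA).subset (fun a ha b hb hab => ?_) ⟨x, hx, hx'⟩
    obtain ⟨A'', hA'', hb'⟩ := (hU b).1 ⟨A, hA, hb⟩
    by_contra hb''
    exact hTr A' hA' A'' hA'' (by rintro rfl; exact hb'' hb') a ha b hb' hab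
  have h₂ : A' ⊆ A := by
    refine (hT A' hA').subset (fun a ha b hb hab => ?_) ⟨x, hx', hx⟩
    obtain ⟨A'', hA'', hb'⟩ := (hU b).2 ⟨A', hA', hb⟩
    by_contra hb''
    exact hSr A hA A'' hA'' (by rintro rfl; exact hb'' hb') a ha b hb' hab
  exact h₁.antisymm h₂ ▸ hA'

theorem ConnectedIn.perm {r : X → X → Prop} (hr : ∀ x y, r x y → r y x) {Ss Ts : List (Set X)}
    (hU : ∀ x, (∃ A ∈ Ss, x ∈ A) ↔ ∃ A ∈ Ts, x ∈ A)
    (hS : ∀ A ∈ Ss, ConnectedIn r A) (hT : ∀ A ∈ Ts, ConnectedIn r A)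
    (hSr : Ss.Pairwise fun A A' => ∀ x ∈ A, ∀ y ∈ A', x ≠ y ∧ ¬ r x y)
    (hTr : Ts.Pairwise fun A A' => ∀ x ∈ A, ∀ y ∈ A', x ≠ y ∧ ¬ r x y) : Ss.Perm Ts := by
  have nodup : ∀ {Us : List (Set X)}, (∀ A ∈ Us, ConnectedIn r A) →
      (Us.Pairwise fun A A' => ∀ x ∈ A, ∀ y ∈ A', x ≠ y ∧ ¬ r x y) → Us.Nodup := by
    intro Us hc hp
    refine hp.imp_of_mem fun {A A'} hA hA' h hAA' => ?_
    obtain ⟨x, hx⟩ := (hc A hA).1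
    exact (h x hx x (hAA' ▸ hx)).1 rfl
  have sep : ∀ {Us : List (Set X)},
      (Us.Pairwise fun A A' => ∀ x ∈ A, ∀ y ∈ A', x ≠ y ∧ ¬ r x y) →
      ∀ A ∈ Us, ∀ A' ∈ Us, A ≠ A' → ∀ x ∈ A, ∀ y ∈ A', ¬ r x y := by
    intro Us hp A hA A' hA' hne x hx y hy
    have : Std.Symm fun A A' : Set X => ∀ x ∈ A, ∀ y ∈ A', x ≠ y ∧ ¬ r x y :=
      ⟨fun A A' h x hx y hy => ⟨(h y hy x hx).1.symm, fun hxy => (h y hy x hx).2 (hr x y hxy)⟩⟩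
    exact (hp.forall hA hA' hne x hx y hy).2
  exact (List.perm_ext_iff_of_nodup (nodup hS hSr) (nodup hT hTr)).2 fun A =>
    ⟨mem_of_mem hU hS hT (sep hSr) (sep hTr),
      mem_of_mem (fun x => (hU x).symm) hT hS (sep hTr) (sep hSr)⟩

theorem List.Forall₂.comp_of_mem {α β γ : Type*} {R : α → β → Prop} {Q : β → γ → Prop}
    {T : α → γ → Prop} {l : List α} {m : List β} {n : List γ} (h₁ : List.Forall₂ R l m)
    (h₂ : List.Forall₂ Q m n)
    (h : ∀ a ∈ l, ∀ b, ∀ c ∈ n, R a b → Q b c → T a c) : List.Forall₂ T l n := by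
  induction h₁ generalizing n with
  | nil => cases h₂; exact .nil
  | cons hab _ ih =>
    cases h₂ with
    | cons hbc h₂ =>
      exact .cons (h _ (by simp) _ _ (by simp) hab hbc)
        (ih h₂ fun a ha b c hc => h a (by simp [ha]) b c (by simp [hc]))

theorem List.Forall₂.exists_mem_left {α β : Type*} {R : α → β → Prop} {l : List α} {m : List β}
    (h : List.Forall₂ R l m) {b : β} (hb : b ∈ m) : ∃ a ∈ l, R a b := by
  induction h with
  | nil => simp at hb
  | cons hab _ ih =>
    rcases List.mem_cons.1 hb with rfl | hb
    · exact ⟨_, by simp, hab⟩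
    · obtain ⟨a, ha, h⟩ := ih hb
      exact ⟨a, by simp [ha], h⟩

theorem SandTreeList.toList_ofList (t : SandTree B) (l : List (SandTree B)) :
    (SandTreeList.ofList t l).toList = t :: l := by
  induction l generalizing t with
  | nil => rfl
  | cons u us ih => simp [SandTreeList.ofList, SandTreeList.toList, ih]

theorem SandTreeList.toList_ne_nil (ts : SandTreeList B) : ts.toList ≠ [] := by
  cases ts <;> simp [SandTreeList.toList]

theorem PEqL.of_forall₂ : ∀ {ts us : SandTreeList B},
    List.Forall₂ PEq ts.toList us.toList → PEqL ts us
  | .single _, .single _, .cons h _ => .single h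
  | .single _, .cons _ us, .cons _ h => by
    exact absurd (List.forall₂_nil_left_iff.1 h) us.toList_ne_nil
  | .cons _ ts, .single _, .cons _ h => by
    exact absurd (List.forall₂_nil_right_iff.1 h) ts.toList_ne_nil
  | .cons _ _, .cons _ _, .cons h h' => .cons h (.of_forall₂ h')

theorem IsSL.forall_mem : ∀ {ts : SandTreeList B}, IsSL ts → ∀ t ∈ ts.toList, IsS t
  | .single _, .single h, _, ht => by simpa [List.mem_singleton.1 ht] using h
  | .cons _ _, .cons h hs, t, ht => by
    rcases List.mem_cons.1 ht with rfl | ht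
    · exact h
    · exact hs.forall_mem t ht

theorem IsCL.forall_mem : ∀ {ts : SandTreeList B}, IsCL ts → ∀ t ∈ ts.toList, IsC t
  | .single _, .single h, _, ht => by simpa [List.mem_singleton.1 ht] using h
  | .cons _ _, .cons h hs, t, ht => by
    rcases List.mem_cons.1 ht with rfl | ht
    · exact h
    · exact hs.forall_mem t ht

theorem RepresentsAnd.peq {ts us : SandTreeList B} {S : Set X} (hts : IsSL ts) (hus : IsSL us)
    (ht : RepresentsAnd lt lab ts S) (hu : RepresentsAnd lt lab us S)
    (ih : ∀ t ∈ ts.toList, ∀ {S : Set X} {u : SandTree B}, IsA t → IsA u →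
      Represents lt lab t S → Represents lt lab u S → PEq t u) :
    PEq (.and ts) (.and us) := by
  obtain ⟨Ss, hSF, hSU, hSP⟩ := ht.exists_list
  obtain ⟨Ts, hTF, hTU, hTP⟩ := hu.exists_list
  have hperm : Ss.Perm Ts := by
    refine ConnectedIn.perm (fun x y => Or.symm) (fun x => (hSU x).symm.trans (hTU x))
      (fun A hA => ?_) (fun A hA => ?_) hSP hTP
    · obtain ⟨t, ht, h⟩ := hSF.exists_mem_left hA
      exact h.connectedIn_of_isS (hts.forall_mem t ht)
    · obtain ⟨t, ht, h⟩ := hTF.exists_mem_left hA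
      exact h.connectedIn_of_isS (hus.forall_mem t ht)
  obtain ⟨vs, hvs, hvu⟩ := List.perm_comp_forall₂ hperm hTF.flip
  have hF : List.Forall₂ PEq ts.toList vs := hSF.comp_of_mem hvs fun t ht A v hv h h' =>
    ih t ht (.inr (hts.forall_mem t ht)) (.inr (hus.forall_mem v (hvu.subset hv))) h h'
  cases vs with
  | nil => exact absurd (List.forall₂_nil_right_iff.1 hF) ts.toList_ne_nil
  | cons v vs =>
    rw [← SandTreeList.toList_ofList] at hF hvu
    exact .trans (.andCongr (.of_forall₂ hF)) (.andPerm hvu)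

theorem RepresentsSand.peq {ts us : SandTreeList B} {S : Set X} (hts : IsCL ts) (hus : IsCL us)
    (ht : RepresentsSand lt lab ts S) (hu : RepresentsSand lt lab us S)
    (ih : ∀ t ∈ ts.toList, ∀ {S : Set X} {u : SandTree B}, IsA t → IsA u →
      Represents lt lab t S → Represents lt lab u S → PEq t u) :
    PEq (.sand ts) (.sand us) := by
  obtain ⟨Ss, hSF, hSU, hSP⟩ := ht.exists_list
  obtain ⟨Ts, hTF, hTU, hTP⟩ := hu.exists_list
  have hconn : ∀ A ∈ Ss, ConnectedIn (fun x y => ¬ (lt x y ∨ lt y x)) A := fun A hA => by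
    obtain ⟨t, ht, h⟩ := hSF.exists_mem_left hA
    exact h.connectedIn_of_isC (hts.forall_mem t ht)
  have hsep : ∀ A A' : Set X, (∀ x ∈ A, ∀ y ∈ A', lt x y ∧ ¬ lt y x) →
      ∀ x ∈ A, ∀ y ∈ A', x ≠ y ∧ ¬ ¬ (lt x y ∨ lt y x) := fun A A' h x hx y hy =>
    ⟨fun hxy => (h x hx y hy).2 (hxy ▸ (h x hx y hy).1), fun hn => hn (.inl (h x hx y hy).1)⟩
  have hperm : Ss.Perm Ts := by
    refine ConnectedIn.perm (fun x y h h' => h h'.symm) (fun x => (hSU x).symm.trans (hTU x))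
      hconn (fun A hA => ?_) (hSP.imp (hsep _ _)) (hTP.imp (hsep _ _))
    obtain ⟨t, ht, h⟩ := hTF.exists_mem_left hA
    exact h.connectedIn_of_isC (hus.forall_mem t ht)
  have heq : Ss = Ts := by
    refine hperm.eq_of_pairwise (fun A A' hA hA' h h' => ?_) hSP hTP
    obtain ⟨x, hx⟩ := (hconn A hA).1
    obtain ⟨y, hy⟩ := (hconn A' (hperm.mem_iff.2 hA')).1
    exact absurd (h' y hy x hx).1 (h x hx y hy).2
  subst heq
  exact .sandCongr (.of_forall₂ (hSF.comp_of_mem hTF.flip fun t ht A u hu h h' =>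
    ih t ht (.inl (hts.forall_mem t ht)) (.inl (hus.forall_mem u hu)) h h'))

theorem IsA.not_or {ts : SandTreeList B} : ¬ IsA (.or ts) := by
  rintro (h | h) <;> cases h

theorem isA_and_iff {ts : SandTreeList B} : IsA (.and ts) ↔ 2 ≤ ts.toList.length ∧ IsSL ts := by
  refine ⟨?_, fun h => .inl (.and h.1 h.2)⟩
  rintro (h | h) <;> cases h
  exact ⟨by assumption, by assumption⟩

theorem isA_sand_iff {ts : SandTreeList B} : IsA (.sand ts) ↔ 2 ≤ ts.toList.length ∧ IsCL ts := by
  refine ⟨?_, fun h => .inr (.sand h.1 h.2)⟩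
  rintro (h | h) <;> cases h
  exact ⟨by assumption, by assumption⟩

mutual
/-- A labelled relation determines the `A`-term it represents, up to commutativity. -/
theorem Represents.peq : ∀ (t : SandTree B) {S : Set X} {u : SandTree B}, IsA t → IsA u →
    Represents lt lab t S → Represents lt lab u S → PEq t u
  | .or _, _, _, ht, _, _, _ => absurd ht IsA.not_or
  | _, _, .or _, _, hu, _, _ => absurd hu IsA.not_or
  | .atom b, _, .atom c, _, _, ⟨x, hx, hb⟩, ⟨y, hy, hc⟩ => by
    obtain rfl := Set.singleton_injective (hx.symm.trans hy)
    rw [← hb, ← hc]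
    exact .refl _
  | .atom b, _, .and _, _, hu, ht', hu' =>
    absurd hu' (ht'.not_representsAnd_of_isS (.atom b) (isA_and_iff.1 hu).1)
  | .and _, _, .atom b, ht, _, ht', hu' =>
    absurd ht' (hu'.not_representsAnd_of_isS (.atom b) (isA_and_iff.1 ht).1)
  | .atom b, _, .sand _, _, hu, ht', hu' =>
    absurd hu' (ht'.not_representsSand_of_isC (.atom b) (isA_sand_iff.1 hu).1)
  | .sand _, _, .atom b, ht, _, ht', hu' =>
    absurd ht' (hu'.not_representsSand_of_isC (.atom b) (isA_sand_iff.1 ht).1)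
  | .and _, _, .sand _, ht, hu, ht', hu' =>
    absurd hu' (ht'.not_representsSand_of_isC (.and (isA_and_iff.1 ht).1 (isA_and_iff.1 ht).2)
      (isA_sand_iff.1 hu).1)
  | .sand _, _, .and _, ht, hu, ht', hu' =>
    absurd hu' (ht'.not_representsAnd_of_isS (.sand (isA_sand_iff.1 ht).1 (isA_sand_iff.1 ht).2)
      (isA_and_iff.1 hu).1)
  | .and ts, _, .and _, ht, hu, ht', hu' =>
    RepresentsAnd.peq (isA_and_iff.1 ht).2 (isA_and_iff.1 hu).2 ht' hu' (Represents.peq_of_mem ts)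
  | .sand ts, _, .sand _, ht, hu, ht', hu' =>
    RepresentsSand.peq (isA_sand_iff.1 ht).2 (isA_sand_iff.1 hu).2 ht' hu'
      (Represents.peq_of_mem ts)
theorem Represents.peq_of_mem : ∀ (ts : SandTreeList B), ∀ t ∈ ts.toList,
    ∀ {S : Set X} {u : SandTree B}, IsA t → IsA u →
      Represents lt lab t S → Represents lt lab u S → PEq t u
  | .single t, _, h => (List.mem_singleton.1 h) ▸ Represents.peq t
  | .cons t ts, t', h => (List.mem_cons.1 h).elim (fun h => h ▸ Represents.peq t)
      (fun h => Represents.peq_of_mem ts t' h)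
end

end Represents

/-! ### The edge order of a source-sink graph -/

section EdgeOrder

variable {B : Type}

/-- The edge `f` starts where the edge `e` ends. -/
def Follows {ι V : Type} (ends : ι → V × B × V) (e f : ι) : Prop :=
  (ends e).2.2 = (ends f).1

open Relation in
/-- An indexing of the edges of a nonempty source-sink graph in which no edge leaves the sink or
enters the source, and every edge lies on an edge path from the source to the sink. -/
structure SSG.EdgeIndexing (G : SSG B) : Type 1 where
  ι : Type
  fintype : Fintype ι
  nonempty : Nonempty ι
  ends : ι → G.V × B × G.V
  map_ends : Finset.univ.val.map ends = G.E
  tail_ne_sink : ∀ e, (ends e).1 ≠ G.z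
  head_ne_source : ∀ e, (ends e).2.2 ≠ G.s
  exists_source : ∀ e, ∃ e₀, (ends e₀).1 = G.s ∧ ReflTransGen (Follows ends) e₀ e
  exists_sink : ∀ e, ∃ e₁, (ends e₁).2.2 = G.z ∧ ReflTransGen (Follows ends) e e₁

namespace SSG

open Relation

variable {G G' : SSG B}

theorem seqEmbed_injective : Function.Injective (G.seqEmbed G') := by
  intro u v h
  simp only [seqEmbed] at h
  split_ifs at h <;> simp_all

theorem seqEmbed_eq_inr {v : G.V} {w : G'.V} :
    G.seqEmbed G' v = .inr w ↔ v = G.z ∧ w = G'.s := by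
  simp only [seqEmbed]
  split_ifs with h <;> simp [h, eq_comm]

theorem seqEmbed_source : G.seqEmbed G' G.s = (G.seq G').s := by
  simp [seqEmbed, seq, G.ne]

theorem parEmbed_eq_inr {v : G.V} {w : G'.V} :
    G.parEmbed G' v = .inr w ↔ v = G.s ∧ w = G'.s ∨ v = G.z ∧ w = G'.z := by
  simp only [parEmbed]
  split_ifs with h h'
  · subst h; simp [G.ne, eq_comm]
  · subst h'; simp [G.ne.symm, eq_comm]
  · simp [h, h']

theorem parEmbed_injective : Function.Injective (G.parEmbed G') := by
  intro u v h
  have hs := G'.ne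
  have hs' := G'.ne.symm
  simp only [parEmbed] at h
  split_ifs at h <;> simp_all

theorem parEmbed_source : G.parEmbed G' G.s = (G.par G').s :=
  parEmbed_eq_inr.2 (.inl ⟨rfl, rfl⟩)

theorem parEmbed_sink : G.parEmbed G' G.z = (G.par G').z :=
  parEmbed_eq_inr.2 (.inr ⟨rfl, rfl⟩)

namespace EdgeIndexing

attribute [instance] fintype

/-- The order on edges generated by consecutiveness. -/
def lt (I : G.EdgeIndexing) : I.ι → I.ι → Prop := TransGen (Follows I.ends)

def label (I : G.EdgeIndexing) (e : I.ι) : B := (I.ends e).2.1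

/-- Isomorphic graphs have the same labelled edge orders. -/
theorem exists_of_iso (h : G.Iso G') (P : ∀ {ι : Type}, (ι → ι → Prop) → (ι → B) → Prop)
    (I : G.EdgeIndexing) (hI : P I.lt I.label) : ∃ I' : G'.EdgeIndexing, P I'.lt I'.label := by
  obtain ⟨f, hE, hs, hz⟩ := h
  have hF : Follows (fun e => (f (I.ends e).1, (I.ends e).2.1, f (I.ends e).2.2)) =
      Follows I.ends := by
    funext e e'
    exact propext f.injective.eq_iff
  refine ⟨{
    ι := I.ι
    fintype := I.fintype
    nonempty := I.nonempty
    ends := fun e => (f (I.ends e).1, (I.ends e).2.1, f (I.ends e).2.2)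
    map_ends := by rw [← hE, ← I.map_ends, Multiset.map_map]; rfl
    tail_ne_sink := fun e => by simpa [← hz] using I.tail_ne_sink e
    head_ne_source := fun e => by simpa [← hs] using I.head_ne_source e
    exists_source := fun e => by simpa [← hs, hF] using I.exists_source e
    exists_sink := fun e => by simpa [← hz, hF] using I.exists_sink e }, ?_⟩
  change P (TransGen (Follows fun e =>
    (f (I.ends e).1, (I.ends e).2.1, f (I.ends e).2.2))) I.label
  rw [hF]
  exact hI

/-- The edge of a single-edge graph. -/
def single (b : B) : (SSG.single b).EdgeIndexing where
  ι := Unit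
  fintype := inferInstance
  nonempty := inferInstance
  ends _ := (false, b, true)
  map_ends := rfl
  tail_ne_sink _ := Bool.false_ne_true
  head_ne_source _ := Bool.false_ne_true.symm
  exists_source e := ⟨e, rfl, .refl⟩
  exists_sink e := ⟨e, rfl, .refl⟩

variable (I : G.EdgeIndexing) (J : G'.EdgeIndexing)

/-- The edges of a sequential composition, as triples of tail, label and head. -/
def seqEnds : I.ι ⊕ J.ι → (G.seq G').V × B × (G.seq G').V :=
  Sum.elim (fun e => (G.seqEmbed G' (I.ends e).1, (I.ends e).2.1, G.seqEmbed G' (I.ends e).2.2))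
    (fun e => (.inr (J.ends e).1, (J.ends e).2.1, .inr (J.ends e).2.2))

variable {I J}

theorem follows_seqEnds_inl_inl {e f : I.ι} :
    Follows (seqEnds I J) (.inl e) (.inl f) ↔ Follows I.ends e f :=
  seqEmbed_injective.eq_iff

theorem follows_seqEnds_inr_inr {e f : J.ι} :
    Follows (seqEnds I J) (.inr e) (.inr f) ↔ Follows J.ends e f :=
  Sum.inr_injective.eq_iff

theorem follows_seqEnds_inl_inr {e : I.ι} {f : J.ι} :
    Follows (seqEnds I J) (.inl e) (.inr f) ↔ (I.ends e).2.2 = G.z ∧ (J.ends f).1 = G'.s :=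
  seqEmbed_eq_inr

theorem not_follows_seqEnds_inr_inl {e : J.ι} {f : I.ι} :
    ¬ Follows (seqEnds I J) (.inr e) (.inl f) := fun h =>
  I.tail_ne_sink f (seqEmbed_eq_inr.1 (Eq.symm h)).1

variable (I J)

/-- The edge indexing of a sequential composition. -/
def seq : (G.seq G').EdgeIndexing where
  ι := I.ι ⊕ J.ι
  fintype := inferInstance
  nonempty := I.nonempty.map .inl
  ends := seqEnds I J
  map_ends := by
    rw [← Finset.univ_disjSum_univ, Finset.val_disjSum, Multiset.map_disjSum]
    simp only [SSG.seq, ← I.map_ends, ← J.map_ends, Multiset.map_map]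
    rfl
  tail_ne_sink := by
    rintro (e | e) h
    · exact I.tail_ne_sink e (seqEmbed_eq_inr.1 h).1
    · exact J.tail_ne_sink e (Sum.inr_injective h)
  head_ne_source := by
    rintro (e | e) h
    · exact I.head_ne_source e (seqEmbed_injective (h.trans seqEmbed_source.symm))
    · exact Sum.inr_ne_inl h
  exists_source := by
    rintro (e | e)
    · obtain ⟨e₀, h₀, h⟩ := I.exists_source e
      refine ⟨.inl e₀, (congrArg _ h₀).trans seqEmbed_source, ?_⟩
      exact h.lift Sum.inl fun _ _ => follows_seqEnds_inl_inl.2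
    · obtain ⟨f₀, hf₀, hf⟩ := J.exists_source e
      obtain ⟨e₁, he₁, -⟩ := I.exists_sink (Classical.choice I.nonempty)
      obtain ⟨e₀, he₀, he⟩ := I.exists_source e₁
      refine ⟨.inl e₀, (congrArg _ he₀).trans seqEmbed_source, ?_⟩
      exact ((he.lift Sum.inl fun _ _ => follows_seqEnds_inl_inl.2).tail
        (follows_seqEnds_inl_inr.2 ⟨he₁, hf₀⟩)).trans
          (hf.lift Sum.inr fun _ _ => follows_seqEnds_inr_inr.2)
  exists_sink := by
    rintro (e | e)
    · obtain ⟨e₁, he₁, he⟩ := I.exists_sink e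
      obtain ⟨f₀, hf₀, -⟩ := J.exists_source (Classical.choice J.nonempty)
      obtain ⟨f₁, hf₁, hf⟩ := J.exists_sink f₀
      refine ⟨.inr f₁, congrArg Sum.inr hf₁, ?_⟩
      exact ((he.lift Sum.inl fun _ _ => follows_seqEnds_inl_inl.2).tail
        (follows_seqEnds_inl_inr.2 ⟨he₁, hf₀⟩)).trans
          (hf.lift Sum.inr fun _ _ => follows_seqEnds_inr_inr.2)
    · obtain ⟨f₁, hf₁, hf⟩ := J.exists_sink e
      refine ⟨.inr f₁, congrArg Sum.inr hf₁, ?_⟩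
      exact hf.lift Sum.inr fun _ _ => follows_seqEnds_inr_inr.2

variable {I J}

theorem exists_of_seq_lt_inl {x : I.ι ⊕ J.ι} {f : I.ι} (h : (I.seq J).lt x (.inl f)) :
    ∃ e, x = .inl e ∧ I.lt e f := by
  refine TransGen.exists_of_backward_closed (r := Follows (seqEnds I J)) (f := Sum.inl) ?_ h
  rintro a (y | y) h
  · exact ⟨y, rfl, follows_seqEnds_inl_inl.1 h⟩
  · exact absurd h not_follows_seqEnds_inr_inl

theorem exists_of_seq_lt_inr {e : J.ι} {x : I.ι ⊕ J.ι} (h : (I.seq J).lt (.inr e) x) :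
    ∃ f, x = .inr f ∧ J.lt e f := by
  refine TransGen.exists_of_forward_closed (r := Follows (seqEnds I J)) (f := Sum.inr) ?_ h
  rintro a (y | y) h
  · exact absurd h not_follows_seqEnds_inr_inl
  · exact ⟨y, rfl, follows_seqEnds_inr_inr.1 h⟩

theorem seq_lt_inl_inl {e f : I.ι} : (I.seq J).lt (.inl e) (.inl f) ↔ I.lt e f := by
  refine ⟨fun h => ?_, fun h => h.lift Sum.inl fun _ _ => follows_seqEnds_inl_inl.2⟩
  obtain ⟨e', he, h⟩ := exists_of_seq_lt_inl h
  rwa [Sum.inl_injective he]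

theorem seq_lt_inr_inr {e f : J.ι} : (I.seq J).lt (.inr e) (.inr f) ↔ J.lt e f := by
  refine ⟨fun h => ?_, fun h => h.lift Sum.inr fun _ _ => follows_seqEnds_inr_inr.2⟩
  obtain ⟨e', he, h⟩ := exists_of_seq_lt_inr h
  rwa [Sum.inr_injective he]

theorem seq_lt_inl_inr (e : I.ι) (f : J.ι) : (I.seq J).lt (.inl e) (.inr f) := by
  obtain ⟨e₁, he₁, he⟩ := I.exists_sink e
  obtain ⟨f₀, hf₀, hf⟩ := J.exists_source f
  exact (TransGen.tail' (he.lift Sum.inl fun _ _ => follows_seqEnds_inl_inl.2)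
    (follows_seqEnds_inl_inr.2 ⟨he₁, hf₀⟩)).trans_left
      (hf.lift Sum.inr fun _ _ => follows_seqEnds_inr_inr.2)

theorem not_seq_lt_inr_inl (e : J.ι) (f : I.ι) : ¬ (I.seq J).lt (.inr e) (.inl f) := fun h => by
  obtain ⟨e', he, -⟩ := exists_of_seq_lt_inl h
  exact Sum.inr_ne_inl he

variable (I J)

/-- The edges of a parallel composition, as triples of tail, label and head. -/
def parEnds : I.ι ⊕ J.ι → (G.par G').V × B × (G.par G').V :=
  Sum.elim (fun e => (G.parEmbed G' (I.ends e).1, (I.ends e).2.1, G.parEmbed G' (I.ends e).2.2))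
    (fun e => (.inr (J.ends e).1, (J.ends e).2.1, .inr (J.ends e).2.2))

variable {I J}

theorem follows_parEnds_inl_inl {e f : I.ι} :
    Follows (parEnds I J) (.inl e) (.inl f) ↔ Follows I.ends e f :=
  parEmbed_injective.eq_iff

theorem follows_parEnds_inr_inr {e f : J.ι} :
    Follows (parEnds I J) (.inr e) (.inr f) ↔ Follows J.ends e f :=
  Sum.inr_injective.eq_iff

theorem not_follows_parEnds_inl_inr {e : I.ι} {f : J.ι} :
    ¬ Follows (parEnds I J) (.inl e) (.inr f) := fun h =>
  (parEmbed_eq_inr.1 h).elim (fun h => I.head_ne_source e h.1) (fun h => J.tail_ne_sink f h.2)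

theorem not_follows_parEnds_inr_inl {e : J.ι} {f : I.ι} :
    ¬ Follows (parEnds I J) (.inr e) (.inl f) := fun h =>
  (parEmbed_eq_inr.1 (Eq.symm h)).elim (fun h => J.head_ne_source e h.2)
    (fun h => I.tail_ne_sink f h.1)

variable (I J)

/-- The edge indexing of a parallel composition. -/
def par : (G.par G').EdgeIndexing where
  ι := I.ι ⊕ J.ι
  fintype := inferInstance
  nonempty := I.nonempty.map .inl
  ends := parEnds I J
  map_ends := by
    rw [← Finset.univ_disjSum_univ, Finset.val_disjSum, Multiset.map_disjSum]
    simp only [SSG.par, ← I.map_ends, ← J.map_ends, Multiset.map_map]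
    rfl
  tail_ne_sink := by
    rintro (e | e) h
    · exact I.tail_ne_sink e (parEmbed_injective (h.trans parEmbed_sink.symm))
    · exact J.tail_ne_sink e (Sum.inr_injective h)
  head_ne_source := by
    rintro (e | e) h
    · exact I.head_ne_source e (parEmbed_injective (h.trans parEmbed_source.symm))
    · exact J.head_ne_source e (Sum.inr_injective h)
  exists_source := by
    rintro (e | e)
    · obtain ⟨e₀, h₀, h⟩ := I.exists_source e
      refine ⟨.inl e₀, (congrArg _ h₀).trans parEmbed_source, ?_⟩
      exact h.lift Sum.inl fun _ _ => follows_parEnds_inl_inl.2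
    · obtain ⟨e₀, h₀, h⟩ := J.exists_source e
      refine ⟨.inr e₀, congrArg Sum.inr h₀, ?_⟩
      exact h.lift Sum.inr fun _ _ => follows_parEnds_inr_inr.2
  exists_sink := by
    rintro (e | e)
    · obtain ⟨e₁, h₁, h⟩ := I.exists_sink e
      refine ⟨.inl e₁, (congrArg _ h₁).trans parEmbed_sink, ?_⟩
      exact h.lift Sum.inl fun _ _ => follows_parEnds_inl_inl.2
    · obtain ⟨e₁, h₁, h⟩ := J.exists_sink e
      refine ⟨.inr e₁, congrArg Sum.inr h₁, ?_⟩
      exact h.lift Sum.inr fun _ _ => follows_parEnds_inr_inr.2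

variable {I J}

theorem exists_of_par_lt_inl {e : I.ι} {x : I.ι ⊕ J.ι} (h : (I.par J).lt (.inl e) x) :
    ∃ f, x = .inl f ∧ I.lt e f := by
  refine TransGen.exists_of_forward_closed (r := Follows (parEnds I J)) (f := Sum.inl) ?_ h
  rintro a (y | y) h
  · exact ⟨y, rfl, follows_parEnds_inl_inl.1 h⟩
  · exact absurd h not_follows_parEnds_inl_inr

theorem exists_of_par_lt_inr {e : J.ι} {x : I.ι ⊕ J.ι} (h : (I.par J).lt (.inr e) x) :
    ∃ f, x = .inr f ∧ J.lt e f := by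
  refine TransGen.exists_of_forward_closed (r := Follows (parEnds I J)) (f := Sum.inr) ?_ h
  rintro a (y | y) h
  · exact absurd h not_follows_parEnds_inr_inl
  · exact ⟨y, rfl, follows_parEnds_inr_inr.1 h⟩

theorem par_lt_inl_inl {e f : I.ι} : (I.par J).lt (.inl e) (.inl f) ↔ I.lt e f := by
  refine ⟨fun h => ?_, fun h => h.lift Sum.inl fun _ _ => follows_parEnds_inl_inl.2⟩
  obtain ⟨e', he, h⟩ := exists_of_par_lt_inl h
  rwa [Sum.inl_injective he]

theorem par_lt_inr_inr {e f : J.ι} : (I.par J).lt (.inr e) (.inr f) ↔ J.lt e f := by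
  refine ⟨fun h => ?_, fun h => h.lift Sum.inr fun _ _ => follows_parEnds_inr_inr.2⟩
  obtain ⟨e', he, h⟩ := exists_of_par_lt_inr h
  rwa [Sum.inr_injective he]

theorem not_par_lt_inl_inr (e : I.ι) (f : J.ι) : ¬ (I.par J).lt (.inl e) (.inr f) := fun h => by
  obtain ⟨e', he, -⟩ := exists_of_par_lt_inl h
  exact Sum.inr_ne_inl he

theorem not_par_lt_inr_inl (e : J.ι) (f : I.ι) : ¬ (I.par J).lt (.inr e) (.inl f) := fun h => by
  obtain ⟨e', he, -⟩ := exists_of_par_lt_inr h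
  exact Sum.inl_ne_inr he

/-- Any two edge indexings of a graph are isomorphic as labelled orders. -/
theorem exists_equiv (I I' : G.EdgeIndexing) : ∃ e : I.ι ≃ I'.ι,
    (∀ i j, I'.lt (e i) (e j) ↔ I.lt i j) ∧ ∀ i, I'.label (e i) = I.label i := by
  obtain ⟨e, he⟩ := Fintype.exists_equiv_of_map_univ_eq (I.map_ends.trans I'.map_ends.symm)
  have hF : ∀ i j, Follows I'.ends (e i) (e j) ↔ Follows I.ends i j := fun i j => by
    simp only [Follows, he]
  refine ⟨e, fun i j => ⟨fun h => ?_, fun h => h.lift e fun _ _ => (hF _ _).2⟩,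
    fun i => by simp only [label, he]⟩
  have h' : TransGen (Follows I.ends) (e.symm (e i)) (e.symm (e j)) :=
    h.lift e.symm fun a b hab => (hF _ _).1 (by rwa [e.apply_symm_apply, e.apply_symm_apply])
  rwa [e.symm_apply_apply, e.symm_apply_apply] at h'

end EdgeIndexing

end SSG

mutual
theorem exists_represents_of_mem_sem : ∀ (t : SandTree B) {G : SSG B}, G ∈ sem t →
    ∃ I : G.EdgeIndexing, Represents I.lt I.label t Set.univ
  | .atom b, _, h =>
    SSG.EdgeIndexing.exists_of_iso h (fun lt lab => Represents lt lab (.atom b) Set.univ)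
      (SSG.EdgeIndexing.single b) ⟨(), (Set.eq_univ_of_forall fun _ => rfl).symm, rfl⟩
  | .or ts, _, h => exists_represents_of_mem_semOr ts h
  | .and ts, _, h => exists_represents_of_mem_semAnd ts h
  | .sand ts, _, h => exists_represents_of_mem_semSand ts h
theorem exists_represents_of_mem_semOr : ∀ (ts : SandTreeList B) {G : SSG B}, G ∈ semOr ts →
    ∃ I : G.EdgeIndexing, RepresentsOr I.lt I.label ts Set.univ
  | .single t, _, h => exists_represents_of_mem_sem t h
  | .cons t ts, _, h => h.elim
      (fun h => (exists_represents_of_mem_sem t h).imp fun _ => .inl)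
      (fun h => (exists_represents_of_mem_semOr ts h).imp fun _ => .inr)
theorem exists_represents_of_mem_semAnd : ∀ (ts : SandTreeList B) {G : SSG B}, G ∈ semAnd ts →
    ∃ I : G.EdgeIndexing, RepresentsAnd I.lt I.label ts Set.univ
  | .single t, _, h => exists_represents_of_mem_sem t h
  | .cons t ts, _, ⟨G₁, h₁, G₂, h₂, h⟩ => by
    obtain ⟨I, hI⟩ := exists_represents_of_mem_sem t h₁
    obtain ⟨J, hJ⟩ := exists_represents_of_mem_semAnd ts h₂
    have hU : (Set.univ : Set (I.ι ⊕ J.ι)) = Sum.inl '' Set.univ ∪ Sum.inr '' Set.univ := by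
      rw [Set.image_univ, Set.image_univ, Set.range_inl_union_range_inr]
    refine SSG.EdgeIndexing.exists_of_iso h
      (fun lt lab => RepresentsAnd lt lab (.cons t ts) Set.univ) (I.par J)
      ⟨Sum.inl '' Set.univ, Sum.inr '' Set.univ, hU, ?_, ?_, ?_⟩
    · rintro _ ⟨x, -, rfl⟩ _ ⟨y, -, rfl⟩
      exact ⟨Sum.inl_ne_inr, fun h => h.elim (SSG.EdgeIndexing.not_par_lt_inl_inr x y)
        (SSG.EdgeIndexing.not_par_lt_inr_inl y x)⟩
    · exact Represents.image Sum.inl_injective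
        (fun _ _ => SSG.EdgeIndexing.par_lt_inl_inl) (fun _ => rfl) t hI
    · exact RepresentsAnd.image Sum.inr_injective
        (fun _ _ => SSG.EdgeIndexing.par_lt_inr_inr) (fun _ => rfl) ts hJ
theorem exists_represents_of_mem_semSand : ∀ (ts : SandTreeList B) {G : SSG B}, G ∈ semSand ts →
    ∃ I : G.EdgeIndexing, RepresentsSand I.lt I.label ts Set.univ
  | .single t, _, h => exists_represents_of_mem_sem t h
  | .cons t ts, _, ⟨G₁, h₁, G₂, h₂, h⟩ => by
    obtain ⟨I, hI⟩ := exists_represents_of_mem_sem t h₁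
    obtain ⟨J, hJ⟩ := exists_represents_of_mem_semSand ts h₂
    have hU : (Set.univ : Set (I.ι ⊕ J.ι)) = Sum.inl '' Set.univ ∪ Sum.inr '' Set.univ := by
      rw [Set.image_univ, Set.image_univ, Set.range_inl_union_range_inr]
    refine SSG.EdgeIndexing.exists_of_iso h
      (fun lt lab => RepresentsSand lt lab (.cons t ts) Set.univ) (I.seq J)
      ⟨Sum.inl '' Set.univ, Sum.inr '' Set.univ, hU, ?_, ?_, ?_⟩
    · rintro _ ⟨x, -, rfl⟩ _ ⟨y, -, rfl⟩
      exact ⟨SSG.EdgeIndexing.seq_lt_inl_inr x y, SSG.EdgeIndexing.not_seq_lt_inr_inl y x⟩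
    · exact Represents.image Sum.inl_injective
        (fun _ _ => SSG.EdgeIndexing.seq_lt_inl_inl) (fun _ => rfl) t hI
    · exact RepresentsSand.image Sum.inr_injective
        (fun _ _ => SSG.EdgeIndexing.seq_lt_inr_inr) (fun _ => rfl) ts hJ
end

theorem SSG.Iso.refl (G : SSG B) : G.Iso G := ⟨Equiv.refl _, by simp, rfl, rfl⟩

mutual
theorem sem_nonempty : ∀ t : SandTree B, (sem t).Nonempty
  | .atom b => ⟨SSG.single b, .refl _⟩
  | .or ts => semOr_nonempty ts
  | .and ts => semAnd_nonempty ts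
  | .sand ts => semSand_nonempty ts
theorem semOr_nonempty : ∀ ts : SandTreeList B, (semOr ts).Nonempty
  | .single t => sem_nonempty t
  | .cons t _ => (sem_nonempty t).inl
theorem semAnd_nonempty : ∀ ts : SandTreeList B, (semAnd ts).Nonempty
  | .single t => sem_nonempty t
  | .cons t ts =>
    have ⟨G₁, h₁⟩ := sem_nonempty t
    have ⟨G₂, h₂⟩ := semAnd_nonempty ts
    ⟨G₁.par G₂, G₁, h₁, G₂, h₂, .refl _⟩
theorem semSand_nonempty : ∀ ts : SandTreeList B, (semSand ts).Nonempty
  | .single t => sem_nonempty t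
  | .cons t ts =>
    have ⟨G₁, h₁⟩ := sem_nonempty t
    have ⟨G₂, h₂⟩ := semSand_nonempty ts
    ⟨G₁.seq G₂, G₁, h₁, G₂, h₂, .refl _⟩
end

end EdgeOrder

/-- The SP semantics is injective on `A`-terms of the normal-form
grammar (terms being considered modulo commutativity of `OR` and `AND`, as in
the paper's rewriting modulo commutativity): if `⟦a1⟧ = ⟦a2⟧` then `a1 = a2`. -/
theorem semA_injective (B : Type) (a1 a2 : SandTree B) (h1 : IsA a1) (h2 : IsA a2)
    (h : sem a1 = sem a2) : PEq a1 a2 := by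
  obtain ⟨G, hG⟩ := sem_nonempty a1
  obtain ⟨I, hI⟩ := exists_represents_of_mem_sem a1 hG
  obtain ⟨J, hJ⟩ := exists_represents_of_mem_sem a2 (h ▸ hG)
  obtain ⟨e, hlt, hlab⟩ := I.exists_equiv J
  have hI' := Represents.image e.injective hlt hlab a1 hI
  rw [Set.image_univ, e.range_eq_univ] at hI'
  exact Represents.peq a1 h1 h2 hI' hJ
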